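/- Let I ⊆ L₁₆ be nonempty with N_I elements and suppose ρ_I = (1/N_I) Σ_{(α,β)∈I} P_{αβ} is PPT. If there exist γ, δ ∈ {0,1,2,3} such that the intersection of I with the union of the column C_γ and the row R_δ consists of exactly one element, which is either of the form (γ,δ') with δ' ≠ δ or of the form (γ',δ) with γ' ≠ γ, then ρ_I is entangled (and hence bound entangled). -/

import Mathlib

open Matrix
open scoped Kronecker ComplexOrder

noncomputable section

/-- The maximally entangled vector `|Ψ⁺⟩ = (1/√d) ∑ⱼ |j⟩⊗|j⟩`. -/
def maxEntVec (q : Type*) [Fintype q] [DecidableEq q] : q × q → ℂ :=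
  fun x => if x.1 = x.2 then (((Real.sqrt (Fintype.card q) : ℝ) : ℂ))⁻¹ else 0

/-- The projection `P⁺ = |Ψ⁺⟩⟨Ψ⁺|` onto the maximally entangled vector. -/
def Pplus (q : Type*) [Fintype q] [DecidableEq q] : Matrix (q × q) (q × q) ℂ :=
  vecMulVec (maxEntVec q) (star (maxEntVec q))

/-- Separability of a bipartite density matrix: a finite convex combination of tensor
products of density matrices. -/
def Separable {q : Type*} [Fintype q] (ρ : Matrix (q × q) (q × q) ℂ) : Prop :=
  ∃ (n : ℕ) (c : Fin n → ℝ) (ρ₁ ρ₂ : Fin n → Matrix q q ℂ),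
    (∀ i, 0 ≤ c i) ∧ (∑ i, c i) = 1 ∧
    (∀ i, (ρ₁ i).PosSemidef ∧ (ρ₁ i).trace = 1) ∧
    (∀ i, (ρ₂ i).PosSemidef ∧ (ρ₂ i).trace = 1) ∧
    ρ = ∑ i, (c i : ℂ) • (ρ₁ i ⊗ₖ ρ₂ i)

/-- Partial transposition on the first tensor factor. -/
def ptFst {p q : Type*} (ρ : Matrix (p × q) (p × q) ℂ) : Matrix (p × q) (p × q) ℂ :=
  Matrix.of fun x y => ρ (y.1, x.2) (x.1, y.2)

/-- A bipartite state is PPT if its partial transpose is positive semidefinite. -/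
def IsPPT {p q : Type*} [Fintype p] [Fintype q] (ρ : Matrix (p × q) (p × q) ℂ) : Prop :=
  (ptFst ρ).PosSemidef

/-- The Pauli matrices; `pauli 0` is the 2×2 identity. -/
def pauli : Fin 4 → Matrix (Fin 2) (Fin 2) ℂ :=
  ![1, !![0, 1; 1, 0], !![0, -Complex.I; Complex.I, 0], !![1, 0; 0, -1]]

/-- `σ_{αβ} = σ_α ⊗ σ_β`, a 4×4 matrix acting on `ℂ⁴ = ℂ²⊗ℂ²`. -/
def sigma2 (α β : Fin 4) : Matrix (Fin 2 × Fin 2) (Fin 2 × Fin 2) ℂ :=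
  pauli α ⊗ₖ pauli β

/-- `|Ψ_{αβ}⟩ = (1₄ ⊗ σ_{αβ}) |Ψ⁺₄⟩`. -/
def PsiLat (α β : Fin 4) : (Fin 2 × Fin 2) × (Fin 2 × Fin 2) → ℂ :=
  ((1 : Matrix (Fin 2 × Fin 2) (Fin 2 × Fin 2) ℂ) ⊗ₖ sigma2 α β).mulVec
    (maxEntVec (Fin 2 × Fin 2))

/-- `P_{αβ} = |Ψ_{αβ}⟩⟨Ψ_{αβ}|`. -/
def PLat (α β : Fin 4) :
    Matrix ((Fin 2 × Fin 2) × (Fin 2 × Fin 2)) ((Fin 2 × Fin 2) × (Fin 2 × Fin 2)) ℂ :=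
  vecMulVec (PsiLat α β) (star (PsiLat α β))

/-- The lattice state `ρ_I = (1/N_I) ∑_{(α,β)∈I} P_{αβ}`. -/
def rhoLat (I : Finset (Fin 4 × Fin 4)) :
    Matrix ((Fin 2 × Fin 2) × (Fin 2 × Fin 2)) ((Fin 2 × Fin 2) × (Fin 2 × Fin 2)) ℂ :=
  (I.card : ℂ)⁻¹ • ∑ p ∈ I, PLat p.1 p.2

/-- The bilinear pairing `∑ V(j) σ_{αβ}(k,j) W(k)`, i.e. twice the amplitude of
`Ψ_{αβ}` against the product of two vectors of `ℂ²⊗ℂ²`, written as `2×2` arrays. -/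
def latticeAmp (V W : Fin 2 × Fin 2 → ℂ) (α β : Fin 4) : ℂ :=
  ∑ j, ∑ k, V j * sigma2 α β k j * W k

/-- The Lorentzian quadratic form on `ℂ⁴`, computing `4 det X` from the Pauli
coefficients `tr (σ_α X)`. -/
def lorentzForm (t : Fin 4 → ℂ) : ℂ := t 0 ^ 2 - t 1 ^ 2 - t 2 ^ 2 - t 3 ^ 2

lemma det_pauli_ne_zero (α : Fin 4) : (pauli α).det ≠ 0 := by
  fin_cases α <;> simp [pauli, det_fin_two]

/-- The determinant of a vector of `ℂ²⊗ℂ²` regarded as a `2×2` array. -/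
def arrayDet (V : Fin 2 × Fin 2 → ℂ) : ℂ := V (0, 0) * V (1, 1) - V (0, 1) * V (1, 0)

lemma lorentzForm_column (V W : Fin 2 × Fin 2 → ℂ) (α : Fin 4) :
    lorentzForm (fun β => latticeAmp V W α β)
      = 4 * (pauli α).det * arrayDet V * arrayDet W := by
  fin_cases α <;>
    simp [lorentzForm, latticeAmp, arrayDet, sigma2, pauli, det_fin_two,
      Fintype.sum_prod_type, Fin.sum_univ_two] <;>
    ring_nf <;> simp only [Complex.I_sq] <;> ring

lemma lorentzForm_row (V W : Fin 2 × Fin 2 → ℂ) (β : Fin 4) :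
    lorentzForm (fun α => latticeAmp V W α β)
      = 4 * (pauli β).det * arrayDet V * arrayDet W := by
  fin_cases β <;>
    simp [lorentzForm, latticeAmp, arrayDet, sigma2, pauli, det_fin_two,
      Fintype.sum_prod_type, Fin.sum_univ_two] <;>
    ring_nf <;> simp only [Complex.I_sq] <;> ring

lemma eq_zero_of_lorentzForm_eq_zero {t : Fin 4 → ℂ} {a : Fin 4}
    (ht : ∀ b, b ≠ a → t b = 0) (hQ : lorentzForm t = 0) : t a = 0 := by
  unfold lorentzForm at hQ
  fin_cases a <;> simp_all

lemma arrayDet_mul_eq_zero_of_column {V W : Fin 2 × Fin 2 → ℂ} {α : Fin 4}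
    (h : ∀ β, latticeAmp V W α β = 0) : arrayDet V * arrayDet W = 0 := by
  have hQ := lorentzForm_column V W α
  simpa [h, lorentzForm, det_pauli_ne_zero] using hQ.symm

lemma arrayDet_mul_eq_zero_of_row {V W : Fin 2 × Fin 2 → ℂ} {β : Fin 4}
    (h : ∀ α, latticeAmp V W α β = 0) : arrayDet V * arrayDet W = 0 := by
  have hQ := lorentzForm_row V W β
  simpa [h, lorentzForm, det_pauli_ne_zero] using hQ.symm

lemma PsiLat_apply (α β : Fin 4) (x : (Fin 2 × Fin 2) × (Fin 2 × Fin 2)) :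
    PsiLat α β x = 2⁻¹ * sigma2 α β x.2 x.1 := by
  have h4 : Real.sqrt 4 = 2 := by
    rw [show (4 : ℝ) = 2 ^ 2 by norm_num]; exact Real.sqrt_sq (by norm_num)
  obtain ⟨j, k⟩ := x
  simp only [PsiLat, mulVec, dotProduct, maxEntVec, kroneckerMap_apply,
    Fintype.sum_prod_type (α₁ := Fin 2 × Fin 2), one_apply]
  simp [h4, mul_comm]

lemma sum_star_pauli_mul (α β : Fin 4) :
    ∑ a, ∑ b, star (pauli α a b) * pauli β a b = if α = β then 2 else 0 := by
  fin_cases α <;> fin_cases β <;> simp [pauli, Fin.sum_univ_two] <;> norm_num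

lemma star_PsiLat_dotProduct_PsiLat (p q : Fin 4 × Fin 4) :
    star (PsiLat p.1 p.2) ⬝ᵥ PsiLat q.1 q.2 = if p = q then 1 else 0 := by
  have h : star (PsiLat p.1 p.2) ⬝ᵥ PsiLat q.1 q.2
      = 4⁻¹ * ((∑ a, ∑ b, star (pauli p.1 a b) * pauli q.1 a b)
        * ∑ a, ∑ b, star (pauli p.2 a b) * pauli q.2 a b) := by
    simp only [dotProduct, Pi.star_apply, PsiLat_apply, sigma2, kroneckerMap_apply,
      Fintype.sum_prod_type, Fin.sum_univ_two, star_mul', star_inv₀, star_ofNat]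
    ring
  rw [h, sum_star_pauli_mul, sum_star_pauli_mul]
  obtain ⟨a, b⟩ := p
  obtain ⟨c, d⟩ := q
  by_cases h1 : a = c <;> by_cases h2 : b = d <;> simp [h1, h2] <;> norm_num

lemma star_PsiLat_dotProduct_rhoLat (I : Finset (Fin 4 × Fin 4)) (p : Fin 4 × Fin 4) :
    star (PsiLat p.1 p.2) ⬝ᵥ rhoLat I *ᵥ PsiLat p.1 p.2
      = if p ∈ I then (I.card : ℂ)⁻¹ else 0 := by
  simp only [rhoLat, PLat, smul_mulVec, sum_mulVec, dotProduct_smul, dotProduct_sum,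
    vecMulVec_mulVec, star_PsiLat_dotProduct_PsiLat]
  simp

lemma kronecker_mulVec_PsiLat (A B : Matrix (Fin 2 × Fin 2) (Fin 2 × Fin 2) ℂ)
    (α β : Fin 4) (k l : Fin 2 × Fin 2) :
    ((A ⊗ₖ B) *ᵥ PsiLat α β) (k, l) = 2⁻¹ * latticeAmp (A k) (B l) α β := by
  simp only [mulVec, dotProduct, kroneckerMap_apply, PsiLat_apply, latticeAmp,
    Fintype.sum_prod_type (α₁ := Fin 2 × Fin 2), Finset.mul_sum]
  refine Finset.sum_congr rfl fun _ _ => Finset.sum_congr rfl fun _ _ => ?_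
  ring

open scoped MatrixOrder in
lemma Matrix.PosSemidef.exists_eq_conjTranspose_mul_self {q : Type*} [Fintype q]
    [DecidableEq q] {M : Matrix q q ℂ} (hM : M.PosSemidef) : ∃ B : Matrix q q ℂ, M = Bᴴ * B :=
  CStarAlgebra.nonneg_iff_eq_star_mul_self.mp hM.nonneg

/-- A separable state having positive overlap with `v` contains a product vector that overlaps
with `v` and is orthogonal to every vector on which the state vanishes. -/
lemma Separable.exists_product {q : Type*} [Fintype q] [DecidableEq q]
    {ρ : Matrix (q × q) (q × q) ℂ}
    (hρ : Separable ρ) {v : q × q → ℂ} (hv : star v ⬝ᵥ ρ *ᵥ v ≠ 0) :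
    ∃ (A B : Matrix q q ℂ) (x : q × q), ((A ⊗ₖ B) *ᵥ v) x ≠ 0 ∧
      ∀ w, star w ⬝ᵥ ρ *ᵥ w = 0 → ((A ⊗ₖ B) *ᵥ w) x = 0 := by
  obtain ⟨n, c, ρ₁, ρ₂, hc, -, h₁, h₂, rfl⟩ := hρ
  choose A hA using fun i => (h₁ i).1.exists_eq_conjTranspose_mul_self
  choose B hB using fun i => (h₂ i).1.exists_eq_conjTranspose_mul_self
  have key : ∀ w : q × q → ℂ,
      star w ⬝ᵥ (∑ i, (c i : ℂ) • (ρ₁ i ⊗ₖ ρ₂ i)) *ᵥ w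
        = ∑ i, (c i : ℂ) * (star ((A i ⊗ₖ B i) *ᵥ w) ⬝ᵥ (A i ⊗ₖ B i) *ᵥ w) := by
    intro w
    simp only [sum_mulVec, dotProduct_sum, smul_mulVec, dotProduct_smul, smul_eq_mul]
    refine Finset.sum_congr rfl fun i _ => ?_
    rw [hA i, hB i, mul_kronecker_mul, ← conjTranspose_kronecker, ← mulVec_mulVec,
      dotProduct_mulVec, star_mulVec]
  rw [key] at hv
  obtain ⟨i, -, hi⟩ := Finset.exists_ne_zero_of_sum_ne_zero hv
  obtain ⟨x, hx⟩ : ∃ x, ((A i ⊗ₖ B i) *ᵥ v) x ≠ 0 :=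
    Function.ne_iff.mp fun h => hi (by simp [h])
  refine ⟨A i, B i, x, hx, fun w hw => ?_⟩
  rw [key, Finset.sum_eq_zero_iff_of_nonneg fun j _ =>
    mul_nonneg (by exact_mod_cast hc j) (dotProduct_star_self_nonneg _)] at hw
  have h0 := (mul_eq_zero.mp (hw i (Finset.mem_univ i))).resolve_left (left_ne_zero_of_mul hi)
  exact congrFun (dotProduct_star_self_eq_zero.mp h0) x

/-- Proposition 20: a PPT lattice state `ρ_I` is entangled (bound entangled) if there are a
column `C_γ` and a row `R_δ` whose intersection with `I` consists of exactly one element,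
of the form `(γ,δ')` with `δ' ≠ δ`, or `(γ',δ)` with `γ' ≠ γ`. -/
theorem ppt_lattice_state_entangled (I : Finset (Fin 4 × Fin 4)) (hI : I.Nonempty)
    (hppt : IsPPT (rhoLat I))
    (h : ∃ γ δ : Fin 4, ∃ x : Fin 4 × Fin 4,
        (I.filter fun p => p.1 = γ ∨ p.2 = δ) = {x}
          ∧ ((x.1 = γ ∧ x.2 ≠ δ) ∨ (x.2 = δ ∧ x.1 ≠ γ))) :
    ¬ Separable (rhoLat I) := by
  intro hsep
  obtain ⟨γ, δ, x, hx, hcase⟩ := h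
  have hmem : ∀ p : Fin 4 × Fin 4, p ∈ I → (p.1 = γ ∨ p.2 = δ) → p = x := fun p hp hp' =>
    Finset.mem_singleton.mp (hx ▸ Finset.mem_filter.mpr ⟨hp, hp'⟩)
  have hxI : x ∈ I := (Finset.mem_filter.mp (hx ▸ Finset.mem_singleton_self x)).1
  obtain ⟨A, B, ⟨k, l⟩, hne, hzero⟩ := hsep.exists_product (v := PsiLat x.1 x.2) (by
    rw [star_PsiLat_dotProduct_rhoLat, if_pos hxI]
    exact inv_ne_zero (by exact_mod_cast hI.card_pos.ne'))
  rw [kronecker_mulVec_PsiLat] at hne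
  have hamp : ∀ p : Fin 4 × Fin 4, (p.1 = γ ∨ p.2 = δ) → p ≠ x →
      latticeAmp (A k) (B l) p.1 p.2 = 0 := by
    intro p hp hpx
    have h0 := hzero (PsiLat p.1 p.2) (by
      rw [star_PsiLat_dotProduct_rhoLat, if_neg fun hpI => hpx (hmem p hpI hp)])
    rw [kronecker_mulVec_PsiLat] at h0
    simpa using h0
  refine right_ne_zero_of_mul hne ?_
  obtain ⟨a, b⟩ := x
  rcases hcase with ⟨rfl, hb⟩ | ⟨rfl, ha⟩
  · have hdet := arrayDet_mul_eq_zero_of_row (V := A k) (W := B l) (β := δ) fun α =>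
      hamp (α, δ) (Or.inr rfl) fun h => hb (congrArg Prod.snd h).symm
    refine eq_zero_of_lorentzForm_eq_zero (t := fun β => latticeAmp (A k) (B l) a β)
      (fun β hβ => hamp (a, β) (Or.inl rfl) fun h => hβ (congrArg Prod.snd h)) ?_
    rw [lorentzForm_column, mul_assoc, hdet, mul_zero]
  · have hdet := arrayDet_mul_eq_zero_of_column (V := A k) (W := B l) (α := γ) fun β =>
      hamp (γ, β) (Or.inl rfl) fun h => ha (congrArg Prod.fst h).symm
    refine eq_zero_of_lorentzForm_eq_zero (t := fun α => latticeAmp (A k) (B l) α b)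
      (fun α hα => hamp (α, b) (Or.inr rfl) fun h => hα (congrArg Prod.fst h)) ?_
    rw [lorentzForm_row, mul_assoc, hdet, mul_zero]
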